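/- arXiv:1701.01889 — 5 statements merged into one kernel-verified Lean document; each statement's English description precedes it below -/
import Mathlib

section
/- Let X ⊆ ℝ be a nonempty open interval, let w, p, q ∈ C^∞(X) be real-valued with w(x) > 0 for all x ∈ X, and define the first-order operators δf = p·f' + q·f and δ*f = −(1/w)·(p·w·f)' + q·f for f ∈ C^∞(X). Then for every f ∈ C^∞(X) and every x ∈ X one has δ(δ*f)(x) − δ*(δf)(x) = v(x)·f(x), where v = p·(2q' − (p·w'/w)' − p''). In other words, the commutator [δ, δ*] is the operator of multiplication by the function v. -/
open Set

/-- The formal adjoint expanded into its derivative part and its multiplication part. -/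
theorem neg_one_div_mul_deriv_mul_mul {p w f : ℝ → ℝ} {x : ℝ} (hp : DifferentiableAt ℝ p x)
    (hw : DifferentiableAt ℝ w x) (hf : DifferentiableAt ℝ f x) (hx : w x ≠ 0) :
    -(1 / w x) * deriv (fun y => p y * w y * f y) x =
      -(p x * deriv f x) - (deriv p x + p x * deriv w x / w x) * f x := by
  have h := ((hp.hasDerivAt.mul hw.hasDerivAt).mul hf.hasDerivAt).deriv
  have h' : deriv (fun y => p y * w y * f y) x =
      (deriv p x * w x + p x * deriv w x) * f x + p x * w x * deriv f x := h
  rw [h']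
  field_simp
  ring

/-- A smooth function on an open set is differentiable there, and so is its derivative. -/
theorem ContDiffOn.differentiableAt_and_deriv {s : Set ℝ} (hs : IsOpen s) {u : ℝ → ℝ}
    (hu : ContDiffOn ℝ (⊤ : ℕ∞) u s) {x : ℝ} (hx : x ∈ s) :
    DifferentiableAt ℝ u x ∧ DifferentiableAt ℝ (deriv u) x := by
  have h1 : ContDiffOn ℝ 1 (deriv u) s := hu.deriv_of_isOpen hs (WithTop.coe_le_coe.2 (le_top : (1 + 1 : ℕ∞) ≤ ⊤))
  exact ⟨(hu.differentiableOn (by simp)).differentiableAt (hs.mem_nhds hx),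
    (h1.differentiableOn (by simp)).differentiableAt (hs.mem_nhds hx)⟩

/-- On a nonempty open interval `X = Ioo a b`, with smooth `p, q, w`
(`w > 0` on `X`), the operators `δ f = p f' + q f` and `δ* f = -(1/w)(p w f)' + q f`
satisfy the commutator identity `[δ, δ*] f = v · f` on `X`, where
`v = p (2 q' - (p w'/w)' - p'')`. -/
theorem commutator_delta_deltaStar
    (a b : ℝ) (hab : a < b)
    (p q w : ℝ → ℝ)
    (hp : ContDiffOn ℝ (⊤ : ℕ∞) p (Ioo a b))
    (hq : ContDiffOn ℝ (⊤ : ℕ∞) q (Ioo a b))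
    (hw : ContDiffOn ℝ (⊤ : ℕ∞) w (Ioo a b))
    (hwpos : ∀ x ∈ Ioo a b, 0 < w x)
    (δ δs : (ℝ → ℝ) → ℝ → ℝ)
    (hδ : ∀ f x, δ f x = p x * deriv f x + q x * f x)
    (hδs : ∀ f x, δs f x = -(1 / w x) * deriv (fun y => p y * w y * f y) x + q x * f x)
    (v : ℝ → ℝ)
    (hv : ∀ x, v x =
      p x * (2 * deriv q x - deriv (fun y => p y * deriv w y / w y) x - deriv (deriv p) x))
    (f : ℝ → ℝ) (hf : ContDiffOn ℝ (⊤ : ℕ∞) f (Ioo a b))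
    (x : ℝ) (hx : x ∈ Ioo a b) :
    δ (δs f) x - δs (δ f) x = v x * f x := by
  have diff := fun {u : ℝ → ℝ} (hu : ContDiffOn ℝ (⊤ : ℕ∞) u (Ioo a b)) {y : ℝ}
    (hy : y ∈ Ioo a b) => ContDiffOn.differentiableAt_and_deriv isOpen_Ioo hu hy
  have hδs' : ∀ u y, y ∈ Ioo a b → DifferentiableAt ℝ u y → δs u y =
      -(p y * deriv u y) - (deriv p y + p y * deriv w y / w y) * u y + q y * u y := by
    intro u y hy hu
    rw [hδs, neg_one_div_mul_deriv_mul_mul (diff hp hy).1 (diff hw hy).1 hu (hwpos y hy).ne']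
  obtain ⟨hp0, hp1⟩ := diff hp hx
  obtain ⟨hw0, hw1⟩ := diff hw hx
  obtain ⟨hf0, hf1⟩ := diff hf hx
  have hq0 := (diff hq hx).1
  have hg : DifferentiableAt ℝ (fun y => p y * deriv w y / w y) x :=
    (hp0.mul hw1).div hw0 (hwpos x hx).ne'
  have hδf : HasDerivAt (δ f) (deriv p x * deriv f x + p x * deriv (deriv f) x
      + (deriv q x * f x + q x * deriv f x)) x := by
    rw [show δ f = fun y => p y * deriv f y + q y * f y from funext (hδ f)]
    exact (hp0.hasDerivAt.mul hf1.hasDerivAt).add (hq0.hasDerivAt.mul hf0.hasDerivAt)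
  have hδsf : HasDerivAt (δs f) (-(deriv p x * deriv f x + p x * deriv (deriv f) x)
      - ((deriv (deriv p) x + deriv (fun y => p y * deriv w y / w y) x) * f x
        + (deriv p x + p x * deriv w x / w x) * deriv f x)
      + (deriv q x * f x + q x * deriv f x)) x := by
    have h := ((hp0.hasDerivAt.mul hf1.hasDerivAt).neg.sub
      ((hp1.hasDerivAt.add hg.hasDerivAt).mul hf0.hasDerivAt)).add
      (hq0.hasDerivAt.mul hf0.hasDerivAt)
    refine h.congr_of_eventuallyEq ?_
    filter_upwards [isOpen_Ioo.mem_nhds hx] with y hy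
    exact hδs' f y hy (diff hf hy).1
  rw [hδ (δs f), hδs' (δ f) x hx hδf.differentiableAt, hδf.deriv, hδsf.deriv,
    hδs' f x hx hf0, hδ f x, hv]
  ring
end

section
/- For every p ≥ 2 and all positive integers m₁, m₂, the Nazarov–Treil Bellman function B = B_{p,(m₁,m₂)} : ℝ^{m₁} × ℝ^{m₂} → [0,∞), B(ζ,η) = (1/2)β_p(|ζ|,|η|), is continuously differentiable on ℝ^{m₁} × ℝ^{m₂}, and is twice continuously differentiable on the complement of the set {(ζ,η) : η = 0 or |ζ|^p = |η|^q}. -/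
open Real

/-- The Nazarov–Treil function `β_p : [0,∞)² → [0,∞)`, where `q = p/(p-1)` and
`γ(p) = q(q-1)/8`. All powers are real powers. -/
noncomputable def betaP (p s₁ s₂ : ℝ) : ℝ :=
  let q := p / (p - 1)
  let γ := q * (q - 1) / 8
  if s₁ ^ p ≤ s₂ ^ q then
    s₁ ^ p + s₂ ^ q + γ * (s₁ ^ (2 : ℝ) * s₂ ^ (2 - q))
  else
    s₁ ^ p + s₂ ^ q + γ * ((2 / p) * s₁ ^ p + (2 / q - 1) * s₂ ^ q)

/-- The Nazarov–Treil Bellman function `B_{p,(m₁,m₂)}(ζ,η) = (1/2) β_p(|ζ|,|η|)`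
on `ℝ^{m₁} × ℝ^{m₂}`. -/
noncomputable def bellmanB (p : ℝ) (m₁ m₂ : ℕ)
    (ζ : EuclideanSpace ℝ (Fin m₁)) (η : EuclideanSpace ℝ (Fin m₂)) : ℝ :=
  (1 / 2) * betaP p ‖ζ‖ ‖η‖

/-- Raising both sides of `a ^ p ≤ b ^ q` to the power `s / p = t / q`. -/
lemma rpow_le_rpow_of_rpow_le {a b p q s t : ℝ} (ha : 0 ≤ a) (hb : 0 ≤ b) (hp : 0 < p)
    (hs : 0 ≤ s) (hst : p * t = q * s) (hab : a ^ p ≤ b ^ q) :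
    a ^ s ≤ b ^ t := by
  have h := rpow_le_rpow (by positivity) hab (div_nonneg hs hp.le)
  rw [← rpow_mul ha, ← rpow_mul hb] at h
  have h₁ : p * (s / p) = s := by field_simp
  have h₂ : q * (s / p) = t := by field_simp; linarith
  rwa [h₁, h₂] at h

lemma sq_mul_rpow_eq_of_rpow_eq {a b p q : ℝ} (ha : 0 ≤ a) (hb : 0 ≤ b)
    (hpq : p.HolderConjugate q) (hab : a ^ p = b ^ q) :
    a ^ (2 : ℝ) * b ^ (2 - q) = 2 / p * a ^ p + (2 / q - 1) * b ^ q := by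
  have hq := hpq.symm.pos
  have hp0 := hpq.pos
  have hmul := hpq.mul_eq_add
  have hsq : a ^ (2 : ℝ) = b ^ (2 * q - 2) :=
    le_antisymm
      (rpow_le_rpow_of_rpow_le ha hb hp0 (by norm_num)
        (by linarith) hab.le)
      (rpow_le_rpow_of_rpow_le hb ha hq
        (by linarith [hpq.symm.lt]) (by linarith) hab.ge)
  have hcoef : 2 / p + (2 / q - 1) = 1 := by
    field_simp
    linarith
  rw [hab, ← add_mul, hcoef, one_mul, hsq, ← rpow_add' hb]
  · ring_nf
  · ring_nf
    exact hq.ne'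

section NormPow

variable {E F : Type*} [NormedAddCommGroup E] [InnerProductSpace ℝ E]
  [NormedAddCommGroup F] [InnerProductSpace ℝ F]

/-- Away from the origin, the derivative of `‖x‖ ^ r` for an arbitrary real exponent. -/
lemma hasFDerivAt_norm_rpow_of_ne {x : E} (hx : x ≠ 0) (r : ℝ) :
    HasFDerivAt (fun x : E => ‖x‖ ^ r) ((r * ‖x‖ ^ (r - 2)) • innerSL ℝ x) x := by
  apply HasStrictFDerivAt.hasFDerivAt
  convert! (hasStrictFDerivAt_norm_sq x).rpow_const (p := r / 2) (by simp [hx]) using 0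
  simp_rw [← Real.rpow_natCast_mul (norm_nonneg _), ← Nat.cast_smul_eq_nsmul ℝ, smul_smul]
  ring_nf

/-- The vector field `‖x‖ ^ r • x` is `C¹` for `r ≥ 0`. -/
lemma contDiff_norm_rpow_smul {r : ℝ} (hr : 0 ≤ r) :
    ContDiff ℝ 1 (fun x : E => ‖x‖ ^ r • x) := by
  rcases hr.eq_or_lt with rfl | hr
  · simpa using contDiff_fun_id
  have hcont : Continuous fun x : E => ‖x‖ ^ r :=
    continuous_norm.rpow_const fun _ => Or.inr hr.le
  rw [contDiff_one_iff_hasFDerivAt]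
  refine ⟨fun x => ‖x‖ ^ r • ContinuousLinearMap.id ℝ E +
    ((r * ‖x‖ ^ (r - 2)) • innerSL ℝ x).smulRight x, ?_, fun x => ?_⟩
  · refine (hcont.smul continuous_const).add (continuous_iff_continuousAt.2 fun x => ?_)
    rcases eq_or_ne x 0 with rfl | hx
    · have h0 : Filter.Tendsto (fun x : E => r * ‖x‖ ^ r) (nhds 0) (nhds 0) := by
        simpa [hr.ne'] using (hcont.const_mul r).tendsto 0
      unfold ContinuousAt
      beta_reduce
      rw [ContinuousLinearMap.smulRight_zero]
      refine squeeze_zero_norm (fun x => ?_) h0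
      rw [ContinuousLinearMap.norm_smulRight_apply, norm_smul, innerSL_apply_norm, norm_mul,
        norm_of_nonneg hr.le, norm_of_nonneg (rpow_nonneg (norm_nonneg x) _)]
      rcases eq_or_ne x 0 with rfl | hx
      · simp [hr.ne']
      · have hx' : 0 < ‖x‖ := norm_pos_iff.2 hx
        rw [rpow_sub hx', rpow_two]
        apply le_of_eq
        field_simp
    · have h1 : ContinuousAt (fun x : E => ‖x‖ ^ (r - 2)) x :=
        continuous_norm.continuousAt.rpow_const (Or.inl (norm_ne_zero_iff.2 hx))
      have h2 : ContinuousAt (fun x : E => (r * ‖x‖ ^ (r - 2)) • innerSL ℝ x) x :=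
        (h1.const_mul r).smul (innerSL ℝ (E := E)).continuous.continuousAt
      exact ((ContinuousLinearMap.smulRightL ℝ E E).continuous₂.continuousAt.comp
        (h2.prodMk continuousAt_id) :)
  · rcases eq_or_ne x 0 with rfl | hx
    · refine .of_isLittleO ?_
      have h0 : (fun x : E => ‖x‖ ^ r) =o[nhds 0] fun _ => (1 : ℝ) := by
        rw [Asymptotics.isLittleO_one_iff]
        simpa [hr.ne'] using hcont.tendsto 0
      simpa [hr.ne'] using h0.smul_isBigO (Asymptotics.isBigO_refl (fun x : E => x) (nhds 0))
    · exact (hasFDerivAt_norm_rpow_of_ne hx r).smul (hasFDerivAt_id x)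

/-- The function `‖x‖ ^ p` is `C²` for `p ≥ 2`. -/
lemma contDiff_two_norm_rpow {p : ℝ} (hp : 2 ≤ p) :
    ContDiff ℝ 2 (fun x : E => ‖x‖ ^ p) := by
  rw [show (2 : WithTop ℕ∞) = ((1 : ℕ) : WithTop ℕ∞) + 1 from by norm_num,
    contDiff_succ_iff_hasFDerivAt]
  refine ⟨fun x => innerSL ℝ (p • ‖x‖ ^ (p - 2) • x), ?_, fun x => ?_⟩
  · exact (innerSL ℝ (E := E)).contDiff.comp
      ((contDiff_norm_rpow_smul (sub_nonneg.2 hp)).const_smul p)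
  · simpa [smul_smul] using hasFDerivAt_norm_rpow x (show 1 < p by linarith)

/-- The non-separable part of the Nazarov–Treil function, composed with norms. -/
noncomputable def bellmanMixed (p q : ℝ) (ξ : E × F) : ℝ :=
  if ‖ξ.1‖ ^ p ≤ ‖ξ.2‖ ^ q then ‖ξ.1‖ ^ (2 : ℝ) * ‖ξ.2‖ ^ (2 - q)
  else 2 / p * ‖ξ.1‖ ^ p + (2 / q - 1) * ‖ξ.2‖ ^ q

/-- The derivative of `bellmanMixed`, written without a case distinction. -/
noncomputable def bellmanMixedDeriv (p q : ℝ) (ξ : E × F) : E × F →L[ℝ] ℝ :=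
  (innerSL ℝ ((2 * max (‖ξ.1‖ ^ (p - 2)) (‖ξ.2‖ ^ (2 - q))) • ξ.1)).comp
      (ContinuousLinearMap.fst ℝ E F) +
    (innerSL ℝ (((2 - q) * min (‖ξ.1‖ ^ (2 : ℝ) * ‖ξ.2‖ ^ (-q)) (‖ξ.2‖ ^ (q - 2))) • ξ.2)).comp
      (ContinuousLinearMap.snd ℝ E F)

variable {p q : ℝ}

lemma continuous_bellmanMixedDeriv (hp : 2 ≤ p) (hq : 1 < q) (hq₂ : q ≤ 2) :
    Continuous (bellmanMixedDeriv p q : E × F → E × F →L[ℝ] ℝ) := by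
  have h₁ : Continuous fun ξ : E × F =>
      (2 * max (‖ξ.1‖ ^ (p - 2)) (‖ξ.2‖ ^ (2 - q))) • ξ.1 := by
    refine (continuous_const.mul (Continuous.max ?_ ?_)).smul continuous_fst
    · exact continuous_fst.norm.rpow_const fun _ => Or.inr (by linarith)
    · exact continuous_snd.norm.rpow_const fun _ => Or.inr (by linarith)
  have h₂ : Continuous fun ξ : E × F =>
      min (‖ξ.1‖ ^ (2 : ℝ) * ‖ξ.2‖ ^ (-q)) (‖ξ.2‖ ^ (q - 2)) • ξ.2 := by
    refine continuous_iff_continuousAt.2 fun ξ => ?_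
    by_cases hξ : ξ.2 = 0
    · have h0 : Filter.Tendsto (fun ξ : E × F => ‖ξ.2‖ ^ (q - 1)) (nhds ξ) (nhds 0) := by
        have : Continuous fun ξ : E × F => ‖ξ.2‖ ^ (q - 1) :=
          continuous_snd.norm.rpow_const fun _ => Or.inr (by linarith)
        simpa [hξ, (sub_pos.2 hq).ne'] using this.tendsto ξ
      unfold ContinuousAt
      beta_reduce
      rw [hξ, smul_zero]
      refine squeeze_zero_norm (fun η => ?_) h0
      rw [norm_smul, norm_of_nonneg (by positivity)]
      rcases eq_or_ne η.2 0 with hη | hη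
      · simp [hη, (sub_pos.2 hq).ne']
      · calc _ ≤ ‖η.2‖ ^ (q - 2) * ‖η.2‖ := by gcongr; exact min_le_right _ _
          _ = ‖η.2‖ ^ (q - 1) := by
            rw [← rpow_add_one (norm_ne_zero_iff.2 hη)]; ring_nf
    · have hξ' : ‖ξ.2‖ ≠ 0 := norm_ne_zero_iff.2 hξ
      refine ContinuousAt.smul (Filter.Tendsto.min (Filter.Tendsto.mul ?_ ?_) ?_)
        continuous_snd.continuousAt
      · exact continuous_fst.norm.continuousAt.rpow_const (Or.inr (by norm_num))
      · exact continuous_snd.norm.continuousAt.rpow_const (Or.inl hξ')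
      · exact continuous_snd.norm.continuousAt.rpow_const (Or.inl hξ')
  have h₃ : Continuous fun ξ : E × F =>
      ((2 - q) * min (‖ξ.1‖ ^ (2 : ℝ) * ‖ξ.2‖ ^ (-q)) (‖ξ.2‖ ^ (q - 2))) • ξ.2 := by
    simp only [mul_smul]
    exact h₂.const_smul (2 - q)
  exact (((innerSL ℝ (E := E)).continuous.comp h₁).clm_comp continuous_const).add
    (((innerSL ℝ (E := F)).continuous.comp h₃).clm_comp continuous_const)

lemma hasFDerivAt_sq_mul_rpow (hp : 2 ≤ p) (hpq : p.HolderConjugate q) (hq₂ : q ≤ 2) {ξ : E × F}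
    (hξ : ‖ξ.1‖ ^ p ≤ ‖ξ.2‖ ^ q) :
    HasFDerivAt (fun ξ : E × F => ‖ξ.1‖ ^ (2 : ℝ) * ‖ξ.2‖ ^ (2 - q))
      (bellmanMixedDeriv p q ξ) ξ := by
  have hq := hpq.symm.pos
  have hmul := hpq.mul_eq_add
  by_cases h0 : ξ.2 = 0
  · have h0' : ξ.1 = 0 := by
      rw [h0, norm_zero, zero_rpow hq.ne'] at hξ
      by_contra h
      exact absurd hξ (not_le.2 (rpow_pos_of_pos (norm_pos_iff.2 h) p))
    obtain rfl : ξ = 0 := Prod.ext h0' h0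
    have hD : bellmanMixedDeriv p q (0 : E × F) = 0 := by simp [bellmanMixedDeriv]
    rw [hD]
    refine .of_isLittleO ?_
    have h₁ : (fun ξ : E × F => ‖ξ.1‖ * ‖ξ.2‖ ^ (2 - q)) =o[nhds 0] fun _ => (1 : ℝ) := by
      rw [Asymptotics.isLittleO_one_iff]
      have : Continuous fun ξ : E × F => ‖ξ.1‖ * ‖ξ.2‖ ^ (2 - q) :=
        continuous_fst.norm.mul
          (continuous_snd.norm.rpow_const fun _ => Or.inr (sub_nonneg.2 hq₂))
      simpa using this.tendsto 0
    have h₂ : (fun ξ : E × F => ‖ξ.1‖) =O[nhds 0] fun ξ : E × F => ‖ξ‖ :=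
      (Asymptotics.isBigO_fst_prod' (f' := fun ξ : E × F => ξ)).norm_norm
    have h₃ := (h₂.mul_isLittleO h₁).norm_right
    simp only [mul_one, norm_norm] at h₃
    simpa [pow_two, mul_assoc] using h₃.of_norm_right
  · have hb : 0 < ‖ξ.2‖ := norm_pos_iff.2 h0
    have hmax : max (‖ξ.1‖ ^ (p - 2)) (‖ξ.2‖ ^ (2 - q)) = ‖ξ.2‖ ^ (2 - q) :=
      max_eq_right (rpow_le_rpow_of_rpow_le (norm_nonneg _) hb.le hpq.pos (by linarith)
        (by linarith) hξ)
    have hmin : min (‖ξ.1‖ ^ (2 : ℝ) * ‖ξ.2‖ ^ (-q)) (‖ξ.2‖ ^ (q - 2)) =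
        ‖ξ.1‖ ^ (2 : ℝ) * ‖ξ.2‖ ^ (-q) := by
      refine min_eq_left ?_
      have h := rpow_le_rpow_of_rpow_le (s := 2) (t := 2 * q - 2) (norm_nonneg _) hb.le hpq.pos
        (by norm_num) (by linarith) hξ
      calc _ ≤ ‖ξ.2‖ ^ (2 * q - 2) * ‖ξ.2‖ ^ (-q) := by gcongr
        _ = _ := by rw [← rpow_add hb]; ring_nf
    have h₁ := (hasFDerivAt_norm_rpow ξ.1 (p := 2) (by norm_num)).comp ξ
      (hasFDerivAt_fst (𝕜 := ℝ) (E := E) (F := F))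
    have h₂ := (hasFDerivAt_norm_rpow_of_ne h0 (2 - q)).comp ξ
      (hasFDerivAt_snd (𝕜 := ℝ) (E := E) (F := F))
    refine (h₁.mul h₂).congr_fderiv ?_
    rw [bellmanMixedDeriv, hmax, hmin]
    ext x <;> simp <;> ring_nf

lemma hasFDerivAt_rpow_add_rpow (hp : 2 ≤ p) (hpq : p.HolderConjugate q) (hq₂ : q ≤ 2) {ξ : E × F}
    (hξ : ‖ξ.2‖ ^ q ≤ ‖ξ.1‖ ^ p) :
    HasFDerivAt (fun ξ : E × F => 2 / p * ‖ξ.1‖ ^ p + (2 / q - 1) * ‖ξ.2‖ ^ q)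
      (bellmanMixedDeriv p q ξ) ξ := by
  have hq := hpq.symm.pos
  have hp0 := hpq.pos
  have hmul := hpq.mul_eq_add
  have hmax : max (‖ξ.1‖ ^ (p - 2)) (‖ξ.2‖ ^ (2 - q)) = ‖ξ.1‖ ^ (p - 2) :=
    max_eq_left (rpow_le_rpow_of_rpow_le (norm_nonneg _) (norm_nonneg _) hq (by linarith)
      (by linarith) hξ)
  have hmin : min (‖ξ.1‖ ^ (2 : ℝ) * ‖ξ.2‖ ^ (-q)) (‖ξ.2‖ ^ (q - 2)) • ξ.2 =
      ‖ξ.2‖ ^ (q - 2) • ξ.2 := by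
    by_cases h0 : ξ.2 = 0
    · simp [h0]
    have hb : 0 < ‖ξ.2‖ := norm_pos_iff.2 h0
    congr 1
    refine min_eq_right ?_
    have h := rpow_le_rpow_of_rpow_le (s := 2 * q - 2) (t := 2) (norm_nonneg _) (norm_nonneg _)
      hq (by linarith [hpq.symm.lt]) (by linarith) hξ
    calc _ = ‖ξ.2‖ ^ (2 * q - 2) * ‖ξ.2‖ ^ (-q) := by rw [← rpow_add hb]; ring_nf
      _ ≤ _ := by gcongr
  have h₁ := ((hasFDerivAt_norm_rpow ξ.1 hpq.lt).comp ξ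
    (hasFDerivAt_fst (𝕜 := ℝ) (E := E) (F := F))).const_mul (2 / p)
  have h₂ := ((hasFDerivAt_norm_rpow ξ.2 hpq.symm.lt).comp ξ
    (hasFDerivAt_snd (𝕜 := ℝ) (E := E) (F := F))).const_mul (2 / q - 1)
  refine (h₁.add h₂).congr_fderiv ?_
  rw [bellmanMixedDeriv, hmax, mul_smul (2 - q), hmin]
  ext x
  · simp
    field_simp
  · simp
    field_simp

lemma hasFDerivAt_bellmanMixed (hp : 2 ≤ p) (hpq : p.HolderConjugate q) (hq₂ : q ≤ 2) (ξ : E × F) :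
    HasFDerivAt (bellmanMixed p q) (bellmanMixedDeriv p q ξ) ξ := by
  have hf : Continuous fun ξ : E × F => ‖ξ.1‖ ^ p :=
    continuous_fst.norm.rpow_const fun _ => Or.inr hpq.nonneg
  have hg : Continuous fun ξ : E × F => ‖ξ.2‖ ^ q :=
    continuous_snd.norm.rpow_const fun _ => Or.inr hpq.symm.nonneg
  have h₁ : HasFDerivWithinAt (bellmanMixed p q) (bellmanMixedDeriv p q ξ)
      {ξ : E × F | ‖ξ.1‖ ^ p ≤ ‖ξ.2‖ ^ q} ξ := by
    by_cases hξ : ‖ξ.1‖ ^ p ≤ ‖ξ.2‖ ^ q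
    · exact (hasFDerivAt_sq_mul_rpow hp hpq hq₂ hξ).hasFDerivWithinAt.congr
        (fun _ h => if_pos h) (if_pos hξ)
    · refine .of_notMem_closure ?_
      rwa [(isClosed_le hf hg).closure_eq]
  have h₂ : HasFDerivWithinAt (bellmanMixed p q) (bellmanMixedDeriv p q ξ)
      {ξ : E × F | ‖ξ.2‖ ^ q ≤ ‖ξ.1‖ ^ p} ξ := by
    have heq : ∀ ξ : E × F, ‖ξ.2‖ ^ q ≤ ‖ξ.1‖ ^ p → bellmanMixed p q ξ =
        2 / p * ‖ξ.1‖ ^ p + (2 / q - 1) * ‖ξ.2‖ ^ q := by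
      intro ξ h
      unfold bellmanMixed
      split_ifs with h'
      · exact sq_mul_rpow_eq_of_rpow_eq (norm_nonneg _) (norm_nonneg _) hpq (le_antisymm h' h)
      · rfl
    by_cases hξ : ‖ξ.2‖ ^ q ≤ ‖ξ.1‖ ^ p
    · exact (hasFDerivAt_rpow_add_rpow hp hpq hq₂ hξ).hasFDerivWithinAt.congr heq (heq ξ hξ)
    · refine .of_notMem_closure ?_
      rwa [(isClosed_le hg hf).closure_eq]
  have huniv : {ξ : E × F | ‖ξ.1‖ ^ p ≤ ‖ξ.2‖ ^ q} ∪ {ξ | ‖ξ.2‖ ^ q ≤ ‖ξ.1‖ ^ p} = Set.univ :=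
    Set.eq_univ_of_forall fun ξ => le_total (‖ξ.1‖ ^ p) (‖ξ.2‖ ^ q)
  rw [← hasFDerivWithinAt_univ, ← huniv]
  exact h₁.union h₂

lemma contDiff_one_bellmanMixed (hp : 2 ≤ p) (hpq : p.HolderConjugate q) (hq₂ : q ≤ 2) :
    ContDiff ℝ 1 (bellmanMixed p q : E × F → ℝ) :=
  contDiff_one_iff_hasFDerivAt.2 ⟨bellmanMixedDeriv p q,
    continuous_bellmanMixedDeriv hp hpq.symm.lt hq₂, hasFDerivAt_bellmanMixed hp hpq hq₂⟩

lemma contDiffAt_two_norm_snd_rpow {ξ : E × F} (hξ : ξ.2 ≠ 0) (r : ℝ) :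
    ContDiffAt ℝ 2 (fun ξ : E × F => ‖ξ.2‖ ^ r) ξ :=
  (contDiffAt_snd.norm ℝ hξ).rpow_const_of_ne (norm_ne_zero_iff.2 hξ)

lemma contDiffAt_two_bellmanMixed (hp : 2 ≤ p) (hpq : p.HolderConjugate q) {ξ : E × F}
    (hξ : ξ.2 ≠ 0) (hne : ‖ξ.1‖ ^ p ≠ ‖ξ.2‖ ^ q) :
    ContDiffAt ℝ 2 (bellmanMixed p q) ξ := by
  have hf : Continuous fun ξ : E × F => ‖ξ.1‖ ^ p :=
    continuous_fst.norm.rpow_const fun _ => Or.inr hpq.nonneg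
  have hg : Continuous fun ξ : E × F => ‖ξ.2‖ ^ q :=
    continuous_snd.norm.rpow_const fun _ => Or.inr hpq.symm.nonneg
  have hfst (r : ℝ) (hr : 2 ≤ r) : ContDiffAt ℝ 2 (fun ξ : E × F => ‖ξ.1‖ ^ r) ξ :=
    ((contDiff_two_norm_rpow hr).comp contDiff_fst).contDiffAt
  rcases hne.lt_or_gt with h | h
  · refine ((hfst 2 le_rfl).mul (contDiffAt_two_norm_snd_rpow hξ (2 - q))).congr_of_eventuallyEq ?_
    filter_upwards [(isOpen_lt hf hg).mem_nhds h] with x hx using if_pos (le_of_lt hx)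
  · refine (((contDiffAt_const (c := 2 / p)).mul (hfst p hp)).add
      ((contDiffAt_const (c := 2 / q - 1)).mul
        (contDiffAt_two_norm_snd_rpow hξ q))).congr_of_eventuallyEq ?_
    filter_upwards [(isOpen_lt hg hf).mem_nhds h] with x hx using if_neg (not_le.2 hx)

end NormPow

lemma bellmanB_eq (p : ℝ) (m₁ m₂ : ℕ) :
    (fun ξ : EuclideanSpace ℝ (Fin m₁) × EuclideanSpace ℝ (Fin m₂) =>
        bellmanB p m₁ m₂ ξ.1 ξ.2) =
      fun ξ => 1 / 2 * (‖ξ.1‖ ^ p + ‖ξ.2‖ ^ (p / (p - 1)) +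
        p / (p - 1) * (p / (p - 1) - 1) / 8 * bellmanMixed p (p / (p - 1)) ξ) := by
  ext ξ
  simp only [bellmanB, betaP, bellmanMixed]
  split_ifs <;> rfl

/-- For `p ≥ 2` and positive integers `m₁, m₂`, the Bellman function
`B = B_{p,(m₁,m₂)}` is `C¹` on `ℝ^{m₁} × ℝ^{m₂}` and `C²` on the complement of the set
`{(ζ,η) : η = 0 or |ζ|^p = |η|^q}`, where `q = p/(p-1)`. -/
theorem bellmanB_contDiff (p : ℝ) (hp : 2 ≤ p) (m₁ m₂ : ℕ) (hm₁ : 0 < m₁) (hm₂ : 0 < m₂) :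
    ContDiff ℝ 1
      (fun ξ : EuclideanSpace ℝ (Fin m₁) × EuclideanSpace ℝ (Fin m₂) =>
        bellmanB p m₁ m₂ ξ.1 ξ.2) ∧
    ContDiffOn ℝ 2
      (fun ξ : EuclideanSpace ℝ (Fin m₁) × EuclideanSpace ℝ (Fin m₂) =>
        bellmanB p m₁ m₂ ξ.1 ξ.2)
      {ξ : EuclideanSpace ℝ (Fin m₁) × EuclideanSpace ℝ (Fin m₂) |
        ¬(ξ.2 = 0 ∨ ‖ξ.1‖ ^ p = ‖ξ.2‖ ^ (p / (p - 1)))} := by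
  have hpq : p.HolderConjugate (p / (p - 1)) := .conjExponent (by linarith)
  have hq₂ : p / (p - 1) ≤ 2 := by
    rw [div_le_iff₀ (by linarith)]
    linarith
  rw [bellmanB_eq]
  refine ⟨?_, fun ξ hξ => ?_⟩
  · exact contDiff_const.mul
      (((contDiff_fst.norm_rpow hpq.lt).add (contDiff_snd.norm_rpow hpq.symm.lt)).add
        (contDiff_const.mul (contDiff_one_bellmanMixed hp hpq hq₂)))
  · obtain ⟨h0, hne⟩ := not_or.1 hξ
    have hfst : ContDiffAt ℝ 2
        (fun ξ : EuclideanSpace ℝ (Fin m₁) × EuclideanSpace ℝ (Fin m₂) => ‖ξ.1‖ ^ p) ξ :=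
      ((contDiff_two_norm_rpow hp).comp contDiff_fst).contDiffAt
    exact (contDiffAt_const.mul ((hfst.add (contDiffAt_two_norm_snd_rpow h0 _)).add
      (contDiffAt_const.mul (contDiffAt_two_bellmanMixed hp hpq h0 hne)))).contDiffWithinAt
end

section
/- For every p ≥ 2 there is a constant C_p > 0, depending only on p (and in particular not on m₁, m₂, or κ), such that for all positive integers m₁, m₂, every κ ∈ (0,1), and every (ζ,η) ∈ ℝ^{m₁} × ℝ^{m₂}, the gradient of the regularized Bellman function B_κ = B * ψ_κ satisfies |∇B_κ(ζ,η)| ≤ C_p·(|ζ|^{p−1} + |η|^{q−1} + |η| + κ^{q−1}), where q = p/(p−1). -/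
open Real MeasureTheory

/-- The Euclidean norm of a point of `ℝ^{m₁} × ℝ^{m₂} ≃ ℝ^{m₁+m₂}`. -/
noncomputable def euclNorm {m₁ m₂ : ℕ}
    (x : EuclideanSpace ℝ (Fin m₁) × EuclideanSpace ℝ (Fin m₂)) : ℝ :=
  Real.sqrt (‖x.1‖ ^ 2 + ‖x.2‖ ^ 2)

/-- The standard bump `ψ(x) = c · exp(−1/(1−|x|²))` for `|x| < 1`, `ψ(x) = 0` otherwise,
on `ℝ^{m₁+m₂}`. -/
noncomputable def bumpPsi (m₁ m₂ : ℕ) (c : ℝ)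
    (x : EuclideanSpace ℝ (Fin m₁) × EuclideanSpace ℝ (Fin m₂)) : ℝ :=
  if euclNorm x < 1 then c * Real.exp (-(1 / (1 - euclNorm x ^ 2))) else 0

/-- The rescaled bump `ψ_κ(x) = κ^{−(m₁+m₂)} ψ(x/κ)`. -/
noncomputable def bumpPsiK (m₁ m₂ : ℕ) (c κ : ℝ)
    (x : EuclideanSpace ℝ (Fin m₁) × EuclideanSpace ℝ (Fin m₂)) : ℝ :=
  (κ ^ (m₁ + m₂))⁻¹ * bumpPsi m₁ m₂ c (κ⁻¹ • x)

/-- The regularized Bellman function `B_κ = B * ψ_κ` (convolution over `ℝ^{m₁+m₂}`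
with respect to Lebesgue measure). -/
noncomputable def regBellman (p : ℝ) (m₁ m₂ : ℕ) (c κ : ℝ)
    (x : EuclideanSpace ℝ (Fin m₁) × EuclideanSpace ℝ (Fin m₂)) : ℝ :=
  ∫ y, bellmanB p m₁ m₂ y.1 y.2 * bumpPsiK m₁ m₂ c κ (x - y)


section RealPower

lemma abs_rpow_sub_rpow_le_of_le {r R x y : ℝ} (hr : 1 ≤ r) (hx : 0 ≤ x) (hxR : x ≤ R)
    (hy : 0 ≤ y) (hyR : y ≤ R) : |x ^ r - y ^ r| ≤ r * R ^ (r - 1) * |x - y| := by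
  have h := Convex.norm_image_sub_le_of_norm_hasDerivWithin_le (f := fun z : ℝ => z ^ r)
    (f' := fun z => r * z ^ (r - 1)) (s := Set.Icc 0 R) (C := r * R ^ (r - 1)) (x := y) (y := x)
    (fun z _ => (Real.hasDerivAt_rpow_const (Or.inr hr)).hasDerivWithinAt)
    (fun z hz => by
      rw [Real.norm_eq_abs, abs_of_nonneg (by have := Real.rpow_nonneg hz.1 (r - 1); positivity)]
      gcongr
      exacts [hz.1, hz.2])
    (convex_Icc 0 R) ⟨hy, hyR⟩ ⟨hx, hxR⟩
  simpa [Real.norm_eq_abs] using h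

lemma abs_rpow_sub_rpow_le_of_ge {a c x y : ℝ} (ha₀ : 0 ≤ a) (ha₁ : a ≤ 1) (hc : 0 < c)
    (hx : c ≤ x) (hy : c ≤ y) : |x ^ a - y ^ a| ≤ c ^ (a - 1) * |x - y| := by
  have h := Convex.norm_image_sub_le_of_norm_hasDerivWithin_le (f := fun z : ℝ => z ^ a)
    (f' := fun z => a * z ^ (a - 1)) (s := Set.Ici c) (C := c ^ (a - 1)) (x := y) (y := x)
    (fun z hz => (Real.hasDerivAt_rpow_const
      (Or.inl (hc.trans_le hz).ne')).hasDerivWithinAt)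
    (fun z hz => by
      have hz' : 0 ≤ z ^ (a - 1) := Real.rpow_nonneg (hc.le.trans hz) _
      rw [Real.norm_eq_abs, abs_of_nonneg (by positivity)]
      calc a * z ^ (a - 1) ≤ 1 * z ^ (a - 1) := by gcongr
        _ ≤ c ^ (a - 1) := by
          rw [one_mul]
          exact Real.rpow_le_rpow_of_nonpos hc hz (by linarith))
    (convex_Ici c) hy hx
  simpa [Real.norm_eq_abs] using h

lemma add_two_mul_rpow_le {a b r : ℝ} (ha : 0 ≤ a) (hb : 0 ≤ b) (hr : 0 ≤ r) :
    (a + 2 * b) ^ r ≤ 4 ^ r * (a ^ r + b ^ r) := by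
  have ha' := Real.rpow_nonneg ha r
  have hb' := Real.rpow_nonneg hb r
  rcases le_total a b with h | h
  · calc (a + 2 * b) ^ r ≤ (4 * b) ^ r := by gcongr; linarith
      _ = 4 ^ r * b ^ r := Real.mul_rpow (by norm_num) hb
      _ ≤ _ := by gcongr; linarith
  · calc (a + 2 * b) ^ r ≤ (4 * a) ^ r := by gcongr; linarith
      _ = 4 ^ r * a ^ r := Real.mul_rpow (by norm_num) ha
      _ ≤ _ := by gcongr; linarith

end RealPower

section BetaP

lemma sub_one_mul_div_sub_one_sub_one {p : ℝ} (hp : 2 ≤ p) : (p - 1) * (p / (p - 1) - 1) = 1 := by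
  have : p - 1 ≠ 0 := by linarith
  field_simp
  ring

lemma one_le_div_sub_one {p : ℝ} (hp : 2 ≤ p) : 1 ≤ p / (p - 1) := by
  rw [le_div_iff₀ (by linarith)]
  linarith

lemma div_sub_one_le_two {p : ℝ} (hp : 2 ≤ p) : p / (p - 1) ≤ 2 := by
  rw [div_le_iff₀ (by linarith)]
  linarith

lemma betaP_eq_min {p q s t : ℝ} (hp : 2 ≤ p) (hq : q = p / (p - 1)) (hs : 0 ≤ s) (ht : 0 ≤ t) :
    betaP p s t = s ^ p + t ^ q + q * (q - 1) / 8 * (min s (t ^ (q - 1)) ^ 2 * t ^ (2 - q) +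
      2 / p * (s ^ p - min s (t ^ (q - 1)) ^ p)) := by
  have hpq : (p - 1) * (q - 1) = 1 := hq ▸ sub_one_mul_div_sub_one_sub_one hp
  have hq1 : 1 ≤ q := hq ▸ one_le_div_sub_one hp
  have hq2 : q ≤ 2 := hq ▸ div_sub_one_le_two hp
  have hc : t ^ q = (t ^ (q - 1)) ^ p := by
    rw [← Real.rpow_mul ht]
    congr 1
    linarith
  have hiff : s ^ p ≤ t ^ q ↔ s ≤ t ^ (q - 1) := by
    rw [hc, Real.rpow_le_rpow_iff hs (Real.rpow_nonneg ht _) (by linarith)]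
  simp only [betaP, ← hq, hiff]
  split_ifs with h
  · rw [min_eq_left h, Real.rpow_two]
    ring
  · rw [min_eq_right (not_le.1 h).le, ← hc]
    have h2 : (t ^ (q - 1)) ^ 2 * t ^ (2 - q) = t ^ q := by
      rw [← Real.rpow_natCast, ← Real.rpow_mul ht, ← Real.rpow_add_of_nonneg ht]
      · congr 1
        push_cast
        ring
      · push_cast
        linarith
      · linarith
    have h3 : 2 / q - 1 = 1 - 2 / p := by
      have hq0 : q ≠ 0 := by linarith
      have hp0 : p ≠ 0 := by linarith
      field_simp
      linarith
    rw [h2, h3]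
    ring

lemma betaP_eq_max {p q s t : ℝ} (hp : 2 ≤ p) (hq : q = p / (p - 1)) (hs : 0 ≤ s) (ht : 0 ≤ t) :
    betaP p s t = s ^ p + t ^ q + q * (q - 1) / 8 * (s ^ 2 * max t (s ^ (p - 1)) ^ (2 - q) +
      (2 / q - 1) * (min t (s ^ (p - 1)) ^ q - s ^ p)) := by
  have hpq : (p - 1) * (q - 1) = 1 := hq ▸ sub_one_mul_div_sub_one_sub_one hp
  have hq1 : 1 ≤ q := hq ▸ one_le_div_sub_one hp
  have hq2 : q ≤ 2 := hq ▸ div_sub_one_le_two hp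
  have hc : s ^ p = (s ^ (p - 1)) ^ q := by
    rw [← Real.rpow_mul hs]
    congr 1
    linarith
  have hiff : s ^ p ≤ t ^ q ↔ s ^ (p - 1) ≤ t := by
    rw [hc, Real.rpow_le_rpow_iff (Real.rpow_nonneg hs _) ht (by linarith)]
  simp only [betaP, ← hq, hiff]
  split_ifs with h
  · rw [max_eq_left h, min_eq_right h, Real.rpow_two, ← hc]
    ring
  · rw [max_eq_right (not_le.1 h).le, min_eq_left (not_le.1 h).le]
    have h2 : s ^ 2 * (s ^ (p - 1)) ^ (2 - q) = s ^ p := by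
      rw [← Real.rpow_natCast, ← Real.rpow_mul hs, ← Real.rpow_add_of_nonneg hs]
      · congr 1
        push_cast
        linarith
      · positivity
      · exact mul_nonneg (by linarith) (by linarith)
    have h3 : 2 / p = 1 - (2 / q - 1) := by
      have hq0 : q ≠ 0 := by linarith
      have hp0 : p ≠ 0 := by linarith
      field_simp
      linarith
    rw [h2, h3]
    ring

lemma abs_betaP_sub_left_le {p q s s' t A : ℝ} (hp : 2 ≤ p) (hq : q = p / (p - 1))
    (hs : 0 ≤ s) (hsA : s ≤ A) (hs' : 0 ≤ s') (hsA' : s' ≤ A) (ht : 0 ≤ t) :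
    |betaP p s t - betaP p s' t| ≤ ((p + 1) * A ^ (p - 1) + t) * |s - s'| := by
  have hq1 : 1 ≤ q := hq ▸ one_le_div_sub_one hp
  have hq2 : q ≤ 2 := hq ▸ div_sub_one_le_two hp
  rw [betaP_eq_min hp hq hs ht, betaP_eq_min hp hq hs' ht]
  set c := t ^ (q - 1) with hc
  have hc0 : 0 ≤ c := Real.rpow_nonneg ht _
  have hm : |min s c - min s' c| ≤ |s - s'| := by
    simpa using abs_min_sub_min_le_max s c s' c
  have hm0 : 0 ≤ min s c := le_min hs hc0
  have hm0' : 0 ≤ min s' c := le_min hs' hc0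
  have hA0 : 0 ≤ A ^ (p - 1) := Real.rpow_nonneg (hs.trans hsA) _
  have e1 := abs_rpow_sub_rpow_le_of_le (by linarith : 1 ≤ p) hs hsA hs' hsA'
  have e2 : |min s c ^ p - min s' c ^ p| ≤ p * A ^ (p - 1) * |s - s'| :=
    (abs_rpow_sub_rpow_le_of_le (by linarith : 1 ≤ p) hm0 ((min_le_left _ _).trans hsA)
      hm0' ((min_le_left _ _).trans hsA')).trans (by gcongr)
  have e3 : |min s c ^ 2 * t ^ (2 - q) - min s' c ^ 2 * t ^ (2 - q)| ≤ 2 * t * |s - s'| := by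
    have hct : c * t ^ (2 - q) = t := by
      rw [hc, ← Real.rpow_add_of_nonneg ht (by linarith) (by linarith)]
      ring_nf
      exact Real.rpow_one t
    have ht2 : 0 ≤ t ^ (2 - q) := Real.rpow_nonneg ht _
    rw [← sub_mul, sq_sub_sq, abs_mul, abs_mul, abs_of_nonneg ht2,
      abs_of_nonneg (add_nonneg hm0 hm0')]
    calc (min s c + min s' c) * |min s c - min s' c| * t ^ (2 - q)
        ≤ (c + c) * |s - s'| * t ^ (2 - q) := by
          gcongr
          exacts [min_le_right _ _, min_le_right _ _]
      _ = 2 * (c * t ^ (2 - q)) * |s - s'| := by ring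
      _ = _ := by rw [hct]
  have hγ0 : 0 ≤ q * (q - 1) / 8 := by
    have : 0 ≤ q - 1 := by linarith
    positivity
  have hγ1 : q * (q - 1) / 8 ≤ 1 / 4 := by nlinarith
  set γ := q * (q - 1) / 8
  set D := |s - s'|
  have hD : 0 ≤ D := abs_nonneg _
  have hp2 : 0 ≤ 2 / p := by positivity
  have e4 : |2 / p * ((s ^ p - s' ^ p) - (min s c ^ p - min s' c ^ p))| ≤
      4 * A ^ (p - 1) * D := by
    rw [abs_mul, abs_of_nonneg hp2]
    calc 2 / p * |(s ^ p - s' ^ p) - (min s c ^ p - min s' c ^ p)|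
        ≤ 2 / p * (p * A ^ (p - 1) * D + p * A ^ (p - 1) * D) := by
          gcongr
          exact (abs_sub _ _).trans (add_le_add e1 e2)
      _ = _ := by
          have : p ≠ 0 := by linarith
          field_simp
          ring
  calc _ = |(s ^ p - s' ^ p) + γ * ((min s c ^ 2 * t ^ (2 - q) - min s' c ^ 2 * t ^ (2 - q)) +
          2 / p * ((s ^ p - s' ^ p) - (min s c ^ p - min s' c ^ p)))| := by
        congr 1
        ring
    _ ≤ p * A ^ (p - 1) * D + 1 / 4 * (2 * t * D + 4 * A ^ (p - 1) * D) := by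
        refine (abs_add_le _ _).trans (add_le_add e1 ?_)
        rw [abs_mul, abs_of_nonneg hγ0]
        gcongr
        exact (abs_add_le _ _).trans (add_le_add e3 e4)
    _ ≤ _ := by nlinarith [mul_nonneg ht hD]

lemma abs_betaP_sub_right_le {p q s t t' R : ℝ} (hp : 2 ≤ p) (hq : q = p / (p - 1))
    (hs : 0 ≤ s) (ht : 0 ≤ t) (htR : t ≤ R) (ht' : 0 ≤ t') (htR' : t' ≤ R) :
    |betaP p s t - betaP p s t'| ≤ 3 * R ^ (q - 1) * |t - t'| := by
  have hpq : (p - 1) * (q - 1) = 1 := hq ▸ sub_one_mul_div_sub_one_sub_one hp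
  have hq1 : 1 ≤ q := hq ▸ one_le_div_sub_one hp
  have hq2 : q ≤ 2 := hq ▸ div_sub_one_le_two hp
  rw [betaP_eq_max hp hq hs ht, betaP_eq_max hp hq hs ht']
  set c := s ^ (p - 1) with hc
  have hc0 : 0 ≤ c := Real.rpow_nonneg hs _
  have hR0 : 0 ≤ R ^ (q - 1) := Real.rpow_nonneg (ht.trans htR) _
  have hm : |min t c - min t' c| ≤ |t - t'| := by
    simpa using abs_min_sub_min_le_max t c t' c
  have hM : |max t c - max t' c| ≤ |t - t'| := by
    simpa using abs_max_sub_max_le_max t c t' c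
  have e1 := abs_rpow_sub_rpow_le_of_le hq1 ht htR ht' htR'
  have e2 : |min t c ^ q - min t' c ^ q| ≤ q * R ^ (q - 1) * |t - t'| :=
    (abs_rpow_sub_rpow_le_of_le hq1 (le_min ht hc0) ((min_le_left _ _).trans htR)
      (le_min ht' hc0) ((min_le_left _ _).trans htR')).trans (by gcongr)
  set D := |t - t'|
  have hD : 0 ≤ D := abs_nonneg _
  have e3 : |s ^ 2 * max t c ^ (2 - q) - s ^ 2 * max t' c ^ (2 - q)| ≤ R ^ (q - 1) * D := by
    rcases hs.eq_or_lt with rfl | hs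
    · simpa using mul_nonneg hR0 hD
    rcases le_or_gt R c with h | h
    · rw [max_eq_right (htR.trans h), max_eq_right (htR'.trans h)]
      simpa using mul_nonneg hR0 hD
    have hsc : s = c ^ (q - 1) := by rw [hc, ← Real.rpow_mul hs.le, hpq, Real.rpow_one]
    have hcpos : 0 < c := Real.rpow_pos_of_pos hs _
    have key : s ^ 2 * c ^ (2 - q - 1) = s := by
      have : c ^ (2 - q - 1) = s⁻¹ := by
        rw [hsc, ← Real.rpow_neg hcpos.le]
        congr 1
        ring
      rw [this]
      field_simp
    rw [← mul_sub, abs_mul, abs_of_nonneg (sq_nonneg s)]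
    calc s ^ 2 * |max t c ^ (2 - q) - max t' c ^ (2 - q)|
        ≤ s ^ 2 * (c ^ (2 - q - 1) * |max t c - max t' c|) := by
          gcongr
          exact abs_rpow_sub_rpow_le_of_ge (by linarith) (by linarith) hcpos
            (le_max_right _ _) (le_max_right _ _)
      _ = s * |max t c - max t' c| := by rw [← mul_assoc, key]
      _ ≤ R ^ (q - 1) * D := by
          gcongr
          rw [hsc]
          exact Real.rpow_le_rpow hc0 h.le (by linarith)
  have hγ0 : 0 ≤ q * (q - 1) / 8 := by
    have : 0 ≤ q - 1 := by linarith
    positivity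
  have hγ1 : q * (q - 1) / 8 ≤ 1 / 4 := by nlinarith
  set γ := q * (q - 1) / 8
  have hq3 : 0 ≤ 2 / q - 1 := by
    rw [sub_nonneg, le_div_iff₀ (by linarith)]
    linarith
  have e4 : |(2 / q - 1) * (min t c ^ q - min t' c ^ q)| ≤ R ^ (q - 1) * D := by
    rw [abs_mul, abs_of_nonneg hq3]
    calc (2 / q - 1) * |min t c ^ q - min t' c ^ q|
        ≤ (2 / q - 1) * (q * R ^ (q - 1) * D) := by gcongr
      _ = (2 - q) * (R ^ (q - 1) * D) := by
          have : q ≠ 0 := by linarith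
          field_simp
      _ ≤ 1 * (R ^ (q - 1) * D) := by
          gcongr
          linarith
      _ = _ := one_mul _
  calc _ = |(t ^ q - t' ^ q) + γ * ((s ^ 2 * max t c ^ (2 - q) - s ^ 2 * max t' c ^ (2 - q)) +
          (2 / q - 1) * (min t c ^ q - min t' c ^ q))| := by
        congr 1
        ring
    _ ≤ 2 * (R ^ (q - 1) * D) + 1 / 4 * (R ^ (q - 1) * D + R ^ (q - 1) * D) := by
        refine (abs_add_le _ _).trans (add_le_add (e1.trans ?_) ?_)
        · rw [mul_assoc]
          gcongr
        · rw [abs_mul, abs_of_nonneg hγ0]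
          gcongr
          exact (abs_add_le _ _).trans (add_le_add e3 e4)
    _ ≤ _ := by nlinarith [mul_nonneg hR0 hD]

lemma abs_betaP_sub_le {p q s s' t t' A R : ℝ} (hp : 2 ≤ p) (hq : q = p / (p - 1))
    (hs : 0 ≤ s) (hsA : s ≤ A) (hs' : 0 ≤ s') (hsA' : s' ≤ A)
    (ht : 0 ≤ t) (htR : t ≤ R) (ht' : 0 ≤ t') (htR' : t' ≤ R) :
    |betaP p s t - betaP p s' t'| ≤
      (p + 1) * (A ^ (p - 1) + R ^ (q - 1) + R) * (|s - s'| + |t - t'|) := by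
  have h1 := abs_betaP_sub_left_le hp hq hs hsA hs' hsA' ht
  have h2 := abs_betaP_sub_right_le hp hq hs' ht htR ht' htR'
  have hA0 : 0 ≤ A ^ (p - 1) := Real.rpow_nonneg (hs.trans hsA) _
  have hR0 : 0 ≤ R ^ (q - 1) := Real.rpow_nonneg (ht.trans htR) _
  have hR : 0 ≤ R := ht.trans htR
  rw [mul_add]
  refine (abs_sub_le _ (betaP p s' t) _).trans (add_le_add (h1.trans ?_) (h2.trans ?_))
  · gcongr
    nlinarith
  · gcongr
    · linarith
    · linarith

lemma betaP_zero {p : ℝ} (hp : 2 ≤ p) : betaP p 0 0 = 0 := by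
  have hq1 := one_le_div_sub_one hp
  have h1 : (0 : ℝ) ^ p = 0 := Real.zero_rpow (by linarith)
  have h2 : (0 : ℝ) ^ (p / (p - 1)) = 0 := Real.zero_rpow (by linarith)
  simp [betaP, h1, h2]

lemma measurable_betaP (p : ℝ) : Measurable fun x : ℝ × ℝ => betaP p x.1 x.2 := by
  unfold betaP
  refine Measurable.ite (measurableSet_le ?_ ?_) ?_ ?_ <;> fun_prop

end BetaP

section Bellman

variable {m₁ m₂ : ℕ}

local notation "𝔼" => EuclideanSpace ℝ (Fin m₁) × EuclideanSpace ℝ (Fin m₂)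

instance isAddHaarMeasure_volume_euclideanSpace_prod : (volume : Measure 𝔼).IsAddHaarMeasure := by
  rw [Measure.volume_eq_prod]
  infer_instance

lemma abs_bellmanB_sub_le {p q A R : ℝ} (hp : 2 ≤ p) (hq : q = p / (p - 1)) {u v : 𝔼}
    (hu₁ : ‖u.1‖ ≤ A) (hv₁ : ‖v.1‖ ≤ A) (hu₂ : ‖u.2‖ ≤ R) (hv₂ : ‖v.2‖ ≤ R) :
    |bellmanB p m₁ m₂ u.1 u.2 - bellmanB p m₁ m₂ v.1 v.2| ≤
      (p + 1) * (A ^ (p - 1) + R ^ (q - 1) + R) * ‖u - v‖ := by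
  have h := abs_betaP_sub_le hp hq (norm_nonneg u.1) hu₁ (norm_nonneg v.1) hv₁
    (norm_nonneg u.2) hu₂ (norm_nonneg v.2) hv₂
  have hA0 : 0 ≤ A ^ (p - 1) := Real.rpow_nonneg ((norm_nonneg _).trans hu₁) _
  have hR : 0 ≤ R := (norm_nonneg _).trans hu₂
  have hR0 : 0 ≤ R ^ (q - 1) := Real.rpow_nonneg hR _
  have h1 : |‖u.1‖ - ‖v.1‖| ≤ ‖u - v‖ := (abs_norm_sub_norm_le _ _).trans (norm_fst_le (u - v))
  have h2 : |‖u.2‖ - ‖v.2‖| ≤ ‖u - v‖ := (abs_norm_sub_norm_le _ _).trans (norm_snd_le (u - v))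
  unfold bellmanB
  rw [← mul_sub, abs_mul, abs_of_pos (by norm_num : (0 : ℝ) < 1 / 2)]
  calc _ ≤ 1 / 2 * ((p + 1) * (A ^ (p - 1) + R ^ (q - 1) + R) * (‖u - v‖ + ‖u - v‖)) := by
        refine mul_le_mul_of_nonneg_left (h.trans ?_) (by norm_num)
        gcongr
    _ = _ := by ring

lemma measurable_bellmanB (p : ℝ) : Measurable fun u : 𝔼 => bellmanB p m₁ m₂ u.1 u.2 :=
  ((measurable_betaP p).comp (f := fun u : 𝔼 => (‖u.1‖, ‖u.2‖)) (by fun_prop)).const_mul _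

lemma norm_le_euclNorm (x : 𝔼) : ‖x‖ ≤ euclNorm x := by
  refine max_le (Real.le_sqrt_of_sq_le ?_) (Real.le_sqrt_of_sq_le ?_)
  · exact le_add_of_nonneg_right (sq_nonneg _)
  · exact le_add_of_nonneg_left (sq_nonneg _)

lemma bumpPsiK_nonneg {c κ : ℝ} (hc : 0 < c) (hκ : 0 < κ) (x : 𝔼) :
    0 ≤ bumpPsiK m₁ m₂ c κ x := by
  unfold bumpPsiK bumpPsi
  split_ifs <;> positivity

lemma bumpPsiK_eq_zero {c κ : ℝ} (hκ : 0 < κ) {x : 𝔼} (hx : κ < ‖x‖) :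
    bumpPsiK m₁ m₂ c κ x = 0 := by
  have h : ¬ euclNorm (κ⁻¹ • x) < 1 := by
    refine not_lt.2 (le_trans ?_ (norm_le_euclNorm _))
    rw [norm_smul, Real.norm_eq_abs, abs_of_pos (inv_pos.2 hκ), ← div_eq_inv_mul,
      le_div_iff₀ hκ, one_mul]
    exact hx.le
  simp [bumpPsiK, bumpPsi, h]

lemma integrable_bumpPsiK {c κ : ℝ} (hκ : 0 < κ) (h : ∫ x, bumpPsi m₁ m₂ c x = 1) :
    Integrable (bumpPsiK m₁ m₂ c κ) := by
  have hi : Integrable (bumpPsi m₁ m₂ c) := by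
    by_contra hn
    rw [integral_undef hn] at h
    exact zero_ne_one h
  exact (hi.comp_smul (inv_ne_zero hκ.ne')).const_mul _

lemma integral_bumpPsiK {c κ : ℝ} (hκ : 0 < κ) (h : ∫ x, bumpPsi m₁ m₂ c x = 1) :
    ∫ x, bumpPsiK m₁ m₂ c κ x = 1 := by
  unfold bumpPsiK
  rw [integral_const_mul, Measure.integral_comp_inv_smul, h]
  have : 0 < κ ^ (m₁ + m₂) := by positivity
  simp [abs_of_pos hκ, this.ne']

lemma regBellman_eq_integral_sub (p c κ : ℝ) (x : 𝔼) :
    regBellman p m₁ m₂ c κ x =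
      ∫ y, bellmanB p m₁ m₂ (x - y).1 (x - y).2 * bumpPsiK m₁ m₂ c κ y := by
  have : (volume : Measure 𝔼).Regular :=
    Measure.Regular.of_sigmaCompactSpace_of_isLocallyFiniteMeasure _
  rw [regBellman, ← integral_sub_left_eq_self _ _ x]
  simp

lemma integrable_bellmanB_mul_bumpPsiK {p c κ : ℝ} (hp : 2 ≤ p) (hc : 0 < c) (hκ : 0 < κ)
    (h : ∫ x, bumpPsi m₁ m₂ c x = 1) (x : 𝔼) :
    Integrable fun y => bellmanB p m₁ m₂ (x - y).1 (x - y).2 * bumpPsiK m₁ m₂ c κ y := by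
  have hψ := integrable_bumpPsiK hκ h
  set A := ‖x‖ + κ
  refine (hψ.const_mul ((p + 1) * (A ^ (p - 1) + A ^ (p / (p - 1) - 1) + A) * A)).mono'
    (((measurable_bellmanB p).comp (measurable_const.sub measurable_id)).aestronglyMeasurable.mul
      hψ.aestronglyMeasurable) (Filter.Eventually.of_forall fun y => ?_)
  have hy0 := bumpPsiK_nonneg hc hκ y
  rcases lt_or_ge κ ‖y‖ with hy | hy
  · simp [bumpPsiK_eq_zero hκ hy]
  have hxy : ‖x - y‖ ≤ A := (norm_sub_le x y).trans (add_le_add le_rfl hy)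
  have hA : 0 ≤ A := by positivity
  have hb := abs_bellmanB_sub_le (u := x - y) (v := 0) hp rfl
    ((norm_fst_le _).trans hxy) (by simpa) ((norm_snd_le _).trans hxy) (by simpa)
  have h0 : bellmanB p m₁ m₂ (0 : 𝔼).1 (0 : 𝔼).2 = 0 := by simp [bellmanB, betaP_zero hp]
  rw [h0, sub_zero, sub_zero] at hb
  rw [norm_mul, Real.norm_eq_abs, Real.norm_eq_abs, abs_of_nonneg hy0]
  gcongr
  exact hb.trans (by gcongr)

lemma abs_regBellman_sub_le {p q c κ : ℝ} (hp : 2 ≤ p) (hq : q = p / (p - 1)) (hc : 0 < c)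
    (hκ : 0 < κ) (h : ∫ x, bumpPsi m₁ m₂ c x = 1) {x x' : 𝔼} (hx : ‖x' - x‖ ≤ κ) :
    |regBellman p m₁ m₂ c κ x' - regBellman p m₁ m₂ c κ x| ≤
      (p + 1) * ((‖x.1‖ + 2 * κ) ^ (p - 1) + (‖x.2‖ + 2 * κ) ^ (q - 1) + (‖x.2‖ + 2 * κ)) *
        ‖x' - x‖ := by
  set L := (p + 1) * ((‖x.1‖ + 2 * κ) ^ (p - 1) + (‖x.2‖ + 2 * κ) ^ (q - 1) + (‖x.2‖ + 2 * κ))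
  have hi := integrable_bellmanB_mul_bumpPsiK hp hc hκ h
  rw [regBellman_eq_integral_sub, regBellman_eq_integral_sub, ← integral_sub (hi x') (hi x),
    ← Real.norm_eq_abs]
  have hψ := integral_bumpPsiK hκ h
  calc _ ≤ ∫ y, L * ‖x' - x‖ * bumpPsiK m₁ m₂ c κ y := by
        refine norm_integral_le_of_norm_le ((integrable_bumpPsiK hκ h).const_mul _)
          (Filter.Eventually.of_forall fun y => ?_)
        have hy0 := bumpPsiK_nonneg hc hκ y
        rcases lt_or_ge κ ‖y‖ with hy | hy
        · simp [bumpPsiK_eq_zero hκ hy]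
        rw [← sub_mul, norm_mul, Real.norm_eq_abs, Real.norm_eq_abs, abs_of_nonneg hy0]
        have hx1 := (norm_fst_le (x' - x)).trans hx
        have hx2 := (norm_snd_le (x' - x)).trans hx
        have hy1 := (norm_fst_le y).trans hy
        have hy2 := (norm_snd_le y).trans hy
        have a1 : ‖(x - y).1‖ ≤ ‖x.1‖ + 2 * κ := (norm_sub_le x.1 y.1).trans (by linarith)
        have a2 : ‖(x - y).2‖ ≤ ‖x.2‖ + 2 * κ := (norm_sub_le x.2 y.2).trans (by linarith)
        have b1 : ‖(x' - y).1‖ ≤ ‖x.1‖ + 2 * κ := by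
          have e : (x' - y).1 = x.1 + (x' - x).1 - y.1 := by simp
          rw [e]
          exact (norm_sub_le _ _).trans (by linarith [norm_add_le x.1 (x' - x).1])
        have b2 : ‖(x' - y).2‖ ≤ ‖x.2‖ + 2 * κ := by
          have e : (x' - y).2 = x.2 + (x' - x).2 - y.2 := by simp
          rw [e]
          exact (norm_sub_le _ _).trans (by linarith [norm_add_le x.2 (x' - x).2])
        have := abs_bellmanB_sub_le hp hq b1 a1 b2 a2
        rw [sub_sub_sub_cancel_right] at this
        gcongr
    _ = _ := by rw [integral_const_mul, hψ, mul_one]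

end Bellman

/-- For every `p ≥ 2` there is a constant `C_p > 0` depending only on `p`
(not on `m₁`, `m₂`, or `κ`) such that the gradient of the regularized Bellman function
satisfies `|∇B_κ(ζ,η)| ≤ C_p (|ζ|^{p−1} + |η|^{q−1} + |η| + κ^{q−1})`, with `q = p/(p−1)`. -/
theorem regBellman_gradient_bound (p : ℝ) (hp : 2 ≤ p) :
    ∃ C : ℝ, 0 < C ∧
      ∀ (m₁ m₂ : ℕ), 0 < m₁ → 0 < m₂ →
        ∀ κ ∈ Set.Ioo (0 : ℝ) 1,
          ∀ c : ℝ, 0 < c → (∫ x, bumpPsi m₁ m₂ c x = 1) →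
            ∀ (ζ : EuclideanSpace ℝ (Fin m₁)) (η : EuclideanSpace ℝ (Fin m₂)),
              ‖fderiv ℝ (regBellman p m₁ m₂ c κ) (ζ, η)‖ ≤
                C * (‖ζ‖ ^ (p - 1) + ‖η‖ ^ (p / (p - 1) - 1) + ‖η‖ +
                  κ ^ (p / (p - 1) - 1)) := by
  have hq1 := one_le_div_sub_one hp
  have hq2 := div_sub_one_le_two hp
  set q := p / (p - 1) with hq
  refine ⟨(p + 1) * (4 ^ (p - 1) + 6), by positivity, ?_⟩
  rintro m₁ m₂ - - κ ⟨hκ, hκ1⟩ c hc h ζ η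
  have hlip := norm_fderiv_le_of_lip' ℝ (f := regBellman p m₁ m₂ c κ) (x₀ := (ζ, η))
    (C := (p + 1) * ((‖ζ‖ + 2 * κ) ^ (p - 1) + (‖η‖ + 2 * κ) ^ (q - 1) + (‖η‖ + 2 * κ)))
    (by positivity) (by
      filter_upwards [Metric.closedBall_mem_nhds (ζ, η) hκ] with x hx
      rw [Metric.mem_closedBall, dist_eq_norm] at hx
      exact abs_regBellman_sub_le hp hq hc hκ h hx)
  refine hlip.trans ?_
  rw [mul_assoc]
  refine mul_le_mul_of_nonneg_left ?_ (by linarith)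
  have h1 := add_two_mul_rpow_le (norm_nonneg ζ) hκ.le (by linarith : 0 ≤ p - 1)
  have h2 := add_two_mul_rpow_le (norm_nonneg η) hκ.le (by linarith : 0 ≤ q - 1)
  have h3 : κ ^ (p - 1) ≤ κ ^ (q - 1) :=
    Real.rpow_le_rpow_of_exponent_ge hκ hκ1.le (by linarith)
  have h4 : κ ≤ κ ^ (q - 1) := by
    simpa using Real.rpow_le_rpow_of_exponent_ge hκ hκ1.le (by linarith : q - 1 ≤ 1)
  have h5 : (4 : ℝ) ^ (q - 1) ≤ 4 := by
    simpa using Real.rpow_le_rpow_of_exponent_le (by norm_num : (1 : ℝ) ≤ 4)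
      (by linarith : q - 1 ≤ 1)
  have h6 : (0 : ℝ) ≤ 4 ^ (p - 1) := by positivity
  have hκq : 0 ≤ κ ^ (q - 1) := by positivity
  have hζ : 0 ≤ ‖ζ‖ ^ (p - 1) := by positivity
  have hη : 0 ≤ ‖η‖ ^ (q - 1) := by positivity
  have hη' := norm_nonneg η
  calc _ ≤ 4 ^ (p - 1) * (‖ζ‖ ^ (p - 1) + κ ^ (q - 1)) + 4 * (‖η‖ ^ (q - 1) + κ ^ (q - 1)) +
        (‖η‖ + 2 * κ ^ (q - 1)) := by
        refine add_le_add (add_le_add (h1.trans ?_) (h2.trans ?_)) ?_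
        · gcongr
        · gcongr
        · gcongr
    _ ≤ _ := by
        nlinarith [mul_nonneg h6 hη, mul_nonneg h6 hη']
end

section
/- Let h : (0,1) → ℝ be h(s) = log(s+4) − s·log s/(s+1). Then h is twice differentiable on (0,1) with h''(s) = −1/(s+4)² + 2·log s/(s+1)³ + (s−1)/(s·(s+1)²), and h''(s) < 0 for every s ∈ (0,1); in particular h is strictly concave on (0,1). -/
open Real Set

/-- The function `h(s) = log(s+4) − s log s/(s+1)`. -/
noncomputable def hFun (s : ℝ) : ℝ := Real.log (s + 4) - s * Real.log s / (s + 1)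

lemma hasDerivAt_hFun {s : ℝ} (hs : 0 < s) :
    HasDerivAt hFun (1 / (s + 4) - Real.log s / (s + 1) ^ 2 - 1 / (s + 1)) s := by
  have h4 : s + 4 ≠ 0 := by positivity
  have h1 : s + 1 ≠ 0 := by positivity
  have h := (((hasDerivAt_id' s).add_const 4).log h4).sub
    (((hasDerivAt_id' s).mul (Real.hasDerivAt_log hs.ne')).div
      ((hasDerivAt_id' s).add_const 1) h1)
  refine HasDerivAt.congr_deriv (f := hFun) h ?_
  simp only [Pi.mul_apply]
  field_simp
  ring

lemma hasDerivAt_deriv_hFun {s : ℝ} (hs : 0 < s) :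
    HasDerivAt (deriv hFun)
      (-1 / (s + 4) ^ 2 + 2 * Real.log s / (s + 1) ^ 3 + (s - 1) / (s * (s + 1) ^ 2)) s := by
  have h4 : s + 4 ≠ 0 := by positivity
  have h1 : s + 1 ≠ 0 := by positivity
  have h := (((hasDerivAt_const s (1 : ℝ)).div ((hasDerivAt_id' s).add_const 4) h4).sub
    ((Real.hasDerivAt_log hs.ne').div (((hasDerivAt_id' s).add_const 1).pow 2)
      (pow_ne_zero 2 h1))).sub
    ((hasDerivAt_const s (1 : ℝ)).div ((hasDerivAt_id' s).add_const 1) h1)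
  refine (h.congr_of_eventuallyEq ?_).congr_deriv ?_
  · filter_upwards [Ioi_mem_nhds hs] with x hx
    exact (hasDerivAt_hFun hx).deriv
  · simp only [Pi.pow_apply]
    field_simp
    ring

lemma deriv_deriv_hFun_neg {s : ℝ} (hs : s ∈ Ioo (0 : ℝ) 1) : deriv (deriv hFun) s < 0 := by
  obtain ⟨h0, h1⟩ := hs
  rw [(hasDerivAt_deriv_hFun h0).deriv]
  have ha : -1 / (s + 4) ^ 2 < 0 := div_neg_of_neg_of_pos (by norm_num) (by positivity)
  have hb : 2 * Real.log s / (s + 1) ^ 3 < 0 :=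
    div_neg_of_neg_of_pos (by linarith [Real.log_neg h0 h1]) (by positivity)
  have hc : (s - 1) / (s * (s + 1) ^ 2) < 0 :=
    div_neg_of_neg_of_pos (by linarith) (by positivity)
  linarith

/-- `h` is twice differentiable on `(0,1)` with
`h''(s) = −1/(s+4)² + 2 log s/(s+1)³ + (s−1)/(s(s+1)²)`, and `h'' < 0` on `(0,1)`;
in particular `h` is strictly concave on `(0,1)`. -/
theorem hFun_second_deriv :
    (∀ s ∈ Ioo (0 : ℝ) 1,
      DifferentiableAt ℝ hFun s ∧ DifferentiableAt ℝ (deriv hFun) s ∧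
      deriv (deriv hFun) s =
        -1 / (s + 4) ^ 2 + 2 * Real.log s / (s + 1) ^ 3 + (s - 1) / (s * (s + 1) ^ 2) ∧
      deriv (deriv hFun) s < 0) ∧
    StrictConcaveOn ℝ (Ioo (0 : ℝ) 1) hFun := by
  refine ⟨fun s hs => ⟨(hasDerivAt_hFun hs.1).differentiableAt,
    (hasDerivAt_deriv_hFun hs.1).differentiableAt, (hasDerivAt_deriv_hFun hs.1).deriv,
    deriv_deriv_hFun_neg hs⟩, ?_⟩
  exact strictConcaveOn_of_deriv2_neg' (convex_Ioo 0 1)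
    (fun s hs => (hasDerivAt_hFun hs.1).continuousAt.continuousWithinAt)
    fun s hs => deriv_deriv_hFun_neg hs
end

section
/- Let h : (0,1) → ℝ be h(s) = log(s+4) − s·log s/(s+1). Then h is differentiable on (0,1) with h'(s) = 1/(s+4) − log s/(s+1)² − 1/(s+1); moreover h'(7/20) > 0 and h'(2/5) < 0, and consequently h' has exactly one zero s₀ in (0,1), this zero satisfies 7/20 < s₀ < 2/5, and h(s) ≤ h(s₀) for all s ∈ (0,1). -/
open Real Set

/-- The numerator of `h'`: one has `h'(s) = hFunDerivNum s / (s+1)²` for `s > 0`. -/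
noncomputable def hFunDerivNum (s : ℝ) : ℝ := 9 / (s + 4) - 3 - Real.log s

lemma deriv_hFun {s : ℝ} (hs : 0 < s) : deriv hFun s = hFunDerivNum s / (s + 1) ^ 2 := by
  rw [(hasDerivAt_hFun hs).deriv, hFunDerivNum]
  field_simp
  ring

lemma strictAntiOn_hFunDerivNum : StrictAntiOn hFunDerivNum (Ioi 0) := by
  intro a (ha : 0 < a) b _ hab
  have h₁ : Real.log a < Real.log b := Real.log_lt_log ha hab
  have h₂ : 9 / (b + 4) < 9 / (a + 4) := by gcongr
  unfold hFunDerivNum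
  linarith

lemma continuousOn_hFunDerivNum : ContinuousOn hFunDerivNum (Ioi 0) := by
  intro s (hs : 0 < s)
  have h₁ : s + 4 ≠ 0 := by positivity
  have h₂ := hs.ne'
  unfold hFunDerivNum
  apply ContinuousAt.continuousWithinAt
  fun_prop (disch := assumption)

lemma hFunDerivNum_pos : 0 < hFunDerivNum (7 / 20) := by
  have h : Real.log (7 / 20) = Real.log (7 / 10) - Real.log 2 := by
    rw [← Real.log_div (by norm_num) (by norm_num)]
    norm_num
  have := Real.log_le_sub_one_of_pos (show (0 : ℝ) < 7 / 10 by norm_num)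
  have := Real.log_two_gt_d9
  rw [hFunDerivNum, h]
  linarith

lemma hFunDerivNum_neg : hFunDerivNum (2 / 5) < 0 := by
  have h : Real.log (2 / 5) = -(Real.log (5 / 4) + Real.log 2) := by
    rw [← Real.log_mul (by norm_num) (by norm_num), ← Real.log_inv]
    norm_num
  have := Real.log_le_sub_one_of_pos (show (0 : ℝ) < 5 / 4 by norm_num)
  have := Real.log_two_lt_d9
  rw [hFunDerivNum, h]
  linarith

lemma hFun_le_of_hFunDerivNum_eq_zero {s₀ s : ℝ} (h₀ : 0 < s₀) (hz : hFunDerivNum s₀ = 0)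
    (hs : 0 < s) : hFun s ≤ hFun s₀ := by
  have hcont : ContinuousOn hFun (Ioi 0) := fun x hx =>
    (hasDerivAt_hFun hx).continuousAt.continuousWithinAt
  rcases le_total s s₀ with hle | hle
  · refine monotoneOn_of_deriv_nonneg (convex_Icc s s₀)
      (hcont.mono fun x hx => hs.trans_le hx.1) (fun x hx => ?_) (fun x hx => ?_)
      (left_mem_Icc.2 hle) (right_mem_Icc.2 hle) hle
    all_goals
      rw [interior_Icc] at hx
      have hx₀ : 0 < x := hs.trans hx.1
    · exact (hasDerivAt_hFun hx₀).differentiableAt.differentiableWithinAt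
    · have := strictAntiOn_hFunDerivNum hx₀ h₀ hx.2
      rw [deriv_hFun hx₀]
      exact div_nonneg (by linarith) (by positivity)
  · refine antitoneOn_of_deriv_nonpos (convex_Icc s₀ s)
      (hcont.mono fun x hx => h₀.trans_le hx.1) (fun x hx => ?_) (fun x hx => ?_)
      (left_mem_Icc.2 hle) (right_mem_Icc.2 hle) hle
    all_goals
      rw [interior_Icc] at hx
      have hx₀ : 0 < x := h₀.trans hx.1
    · exact (hasDerivAt_hFun hx₀).differentiableAt.differentiableWithinAt
    · have := strictAntiOn_hFunDerivNum h₀ hx₀ hx.1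
      rw [deriv_hFun hx₀]
      exact div_nonpos_of_nonpos_of_nonneg (by linarith) (by positivity)

/-- `h` is differentiable on `(0,1)` with
`h'(s) = 1/(s+4) − log s/(s+1)² − 1/(s+1)`; `h'(7/20) > 0` and `h'(2/5) < 0`; `h'` has
exactly one zero `s₀` in `(0,1)`, this zero satisfies `7/20 < s₀ < 2/5`, and `h` attains
its maximum over `(0,1)` at `s₀`. -/
theorem hFun_first_deriv_and_max :
    (∀ s ∈ Ioo (0 : ℝ) 1,
      DifferentiableAt ℝ hFun s ∧
      deriv hFun s = 1 / (s + 4) - Real.log s / (s + 1) ^ 2 - 1 / (s + 1)) ∧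
    0 < deriv hFun (7 / 20) ∧ deriv hFun (2 / 5) < 0 ∧
    ∃ s₀ ∈ Ioo (0 : ℝ) 1, deriv hFun s₀ = 0 ∧
      (∀ s ∈ Ioo (0 : ℝ) 1, deriv hFun s = 0 → s = s₀) ∧
      7 / 20 < s₀ ∧ s₀ < 2 / 5 ∧
      ∀ s ∈ Ioo (0 : ℝ) 1, hFun s ≤ hFun s₀ := by
  refine ⟨fun s hs => ⟨(hasDerivAt_hFun hs.1).differentiableAt, (hasDerivAt_hFun hs.1).deriv⟩,
    ?_, ?_, ?_⟩
  · rw [deriv_hFun (by norm_num)]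
    exact div_pos hFunDerivNum_pos (by norm_num)
  · rw [deriv_hFun (by norm_num)]
    exact div_neg_of_neg_of_pos hFunDerivNum_neg (by norm_num)
  obtain ⟨s₀, ⟨hl, hr⟩, hz⟩ := intermediate_value_Ioo' (by norm_num : (7 / 20 : ℝ) ≤ 2 / 5)
    (continuousOn_hFunDerivNum.mono fun x hx => lt_of_lt_of_le (by norm_num) hx.1)
    ⟨hFunDerivNum_neg, hFunDerivNum_pos⟩
  have h₀ : 0 < s₀ := by linarith
  refine ⟨s₀, ⟨h₀, by linarith⟩, by rw [deriv_hFun h₀, hz, zero_div], fun s hs hd => ?_, hl, hr,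
    fun s hs => hFun_le_of_hFunDerivNum_eq_zero h₀ hz hs.1⟩
  have hs₁ : (s + 1) ^ 2 ≠ 0 := by have := hs.1; positivity
  rw [deriv_hFun hs.1, div_eq_zero_iff, or_iff_left hs₁] at hd
  exact strictAntiOn_hFunDerivNum.injOn hs.1 h₀ (hd.trans hz.symm)
end
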